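/- Let F be a nontrivial finite group and Γ = F ≀ (F ≀ ℤ) the iterated restricted wreath product, equipped with the word metric of some finite symmetric generating set. Then the fundamental class [Γ] vanishes in H_0^f(Γ) for f(t) = 1 + ln(1+t): there exists an f-controlled 1-chain ψ on Γ with ∂ψ(x) = 1 for all x ∈ Γ. -/

import Mathlib

/-- Word length of `γ` with respect to a generating set `S`. -/
noncomputable def wLen {Γ : Type*} [Group Γ] (S : Set Γ) (γ : Γ) : ℕ :=
  sInf {n | ∃ l : List Γ, (∀ s ∈ l, s ∈ S) ∧ l.length = n ∧ l.prod = γ}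

/-- The left-invariant word metric `d(x,y) = |x⁻¹y|`. -/
noncomputable def wDist {Γ : Type*} [Group Γ] (S : Set Γ) (x y : Γ) : ℕ :=
  wLen S (x⁻¹ * y)

/-- An `f`-controlled 1-chain on a group with the word metric of `S`. -/
structure IsChainW {Γ : Type*} [Group Γ] (S : Set Γ) (f : ℝ → ℝ) (ψ : Γ → Γ → ℝ) : Prop where
  antisymm : ∀ x y, ψ x y = - ψ y x
  finprop : ∃ R > (0:ℝ), ∀ x y, R < (wDist S x y : ℝ) → ψ x y = 0
  bound : ∃ K > (0:ℝ), ∀ x y,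
    |ψ x y| ≤ K * f (max (wLen S x : ℝ) (wLen S y : ℝ))

/-- The restricted direct product `⊕_{b ∈ B} A`: finitely supported functions
`B → A` under pointwise multiplication, as a subgroup of `B → A`. -/
def resProd (B A : Type*) [Group A] : Subgroup (B → A) where
  carrier := {f | (Function.mulSupport f).Finite}
  one_mem' := by
    simp [Function.mulSupport_one]
  mul_mem' := by
    intro f g hf hg
    exact Set.Finite.subset (hf.union hg) (Function.mulSupport_mul f g)
  inv_mem' := by
    intro f hf
    simpa [Function.mulSupport_inv] using hf

/-- Translation of coordinates by `b ∈ B`, as an automorphism of `⊕_{b ∈ B} A`. -/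
def translateEquiv (B A : Type*) [Group B] [Group A] (b : B) :
    resProd B A ≃* resProd B A where
  toFun f := ⟨fun x => (f : B → A) (b⁻¹ * x), by
    apply Set.Finite.subset ((f.2).image (fun x => b * x))
    intro x hx
    exact ⟨b⁻¹ * x, hx, by simp⟩⟩
  invFun f := ⟨fun x => (f : B → A) (b * x), by
    apply Set.Finite.subset ((f.2).image (fun x => b⁻¹ * x))
    intro x hx
    exact ⟨b * x, hx, by simp⟩⟩
  left_inv f := by
    apply Subtype.ext
    funext x
    simp
  right_inv f := by
    apply Subtype.ext
    funext x
    simp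
  map_mul' f g := rfl

/-- The translation action homomorphism `B →* Aut(⊕_{b ∈ B} A)`. -/
def translateHom (B A : Type*) [Group B] [Group A] :
    B →* MulAut (resProd B A) where
  toFun := translateEquiv B A
  map_one' := by
    refine MulEquiv.ext fun f => Subtype.ext (funext fun x => ?_)
    show (f : B → A) ((1:B)⁻¹ * x) = (f : B → A) x
    simp
  map_mul' := by
    intro b c
    refine MulEquiv.ext fun f => Subtype.ext (funext fun x => ?_)
    show (f : B → A) ((b * c)⁻¹ * x) = (f : B → A) (c⁻¹ * (b⁻¹ * x))
    rw [mul_inv_rev, mul_assoc]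

/-- The restricted wreath product `A ≀ B = (⊕_{b ∈ B} A) ⋊ B`. -/
abbrev WreathProd (A B : Type*) [Group A] [Group B] :=
  (resProd B A) ⋊[translateHom B A] B

section Chains

variable {G : Type*} [Group G]

theorem IsChainW.add {S : Set G} {f : ℝ → ℝ} {ψ ψ' : G → G → ℝ}
    (h : IsChainW S f ψ) (h' : IsChainW S f ψ') : IsChainW S f (ψ + ψ') where
  antisymm x y := by
    simp only [Pi.add_apply]
    rw [h.antisymm x y, h'.antisymm x y]
    ring
  finprop := by
    obtain ⟨R, hR, hψ⟩ := h.finprop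
    obtain ⟨R', -, hψ'⟩ := h'.finprop
    refine ⟨max R R', lt_max_of_lt_left hR, fun x y hxy => ?_⟩
    simp [hψ x y ((le_max_left _ _).trans_lt hxy), hψ' x y ((le_max_right _ _).trans_lt hxy)]
  bound := by
    obtain ⟨K, hK, hψ⟩ := h.bound
    obtain ⟨K', hK', hψ'⟩ := h'.bound
    refine ⟨K + K', add_pos hK hK', fun x y => ?_⟩
    rw [add_mul]
    exact (abs_add_le _ _).trans (add_le_add (hψ x y) (hψ' x y))

open Classical in
/-- The chain carrying mass `φ x` along each edge from `x` to `x * s`. -/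
noncomputable def edgeChain (s : G) (φ : G → ℝ) (x y : G) : ℝ :=
  (if x * s = y then φ x else 0) - (if y * s = x then φ y else 0)

open Classical in
theorem edgeChain_eq (s : G) (φ : G → ℝ) (x : G) :
    (fun y => edgeChain s φ y x) = Pi.single (x * s⁻¹) (φ (x * s⁻¹)) - Pi.single (x * s) (φ x) := by
  funext y
  simp only [edgeChain, Pi.sub_apply, Pi.single_apply, ← eq_mul_inv_iff_mul_eq, eq_comm (a := x * s)]
  congr 1
  split_ifs with h
  · rw [h]
  · rfl

theorem finite_support_edgeChain (s : G) (φ : G → ℝ) (x : G) :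
    (Function.support fun y => edgeChain s φ y x).Finite := by
  classical
  rw [edgeChain_eq]
  refine ((Set.finite_singleton (x * s⁻¹)).union (Set.finite_singleton (x * s))).subset ?_
  exact (Function.support_sub _ _).trans
    (Set.union_subset_union Pi.support_single_subset Pi.support_single_subset)

theorem finsum_edgeChain (s : G) (φ : G → ℝ) (x : G) :
    ∑ᶠ y, edgeChain s φ y x = φ (x * s⁻¹) - φ x := by
  classical
  have h (a : G) (r : ℝ) : ∑ᶠ y, (Pi.single a r : G → ℝ) y = r := by
    rw [finsum_eq_single _ a fun y hy => Pi.single_eq_of_ne hy _, Pi.single_eq_same]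
  have hfin (a : G) (r : ℝ) : (Function.support (Pi.single a r : G → ℝ)).Finite :=
    (Set.finite_singleton a).subset Pi.support_single_subset
  rw [edgeChain_eq]
  exact (finsum_sub_distrib (hfin _ _) (hfin _ _)).trans (by rw [h, h])

theorem isChainW_edgeChain {S : Set G} {f : ℝ → ℝ} (hf : MonotoneOn f (Set.Ici 0))
    (s : G) {φ : G → ℝ} {K : ℝ} (hK : 0 < K) (hφ : ∀ x, |φ x| ≤ K * f (wLen S x)) :
    IsChainW S f (edgeChain s φ) where
  antisymm x y := by simp [edgeChain]
  finprop := by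
    refine ⟨max (wLen S s : ℝ) (wLen S s⁻¹) + 1, by positivity, fun x y hxy => ?_⟩
    have h₁ : x * s ≠ y := by
      rintro rfl
      have := le_max_left (wLen S s : ℝ) (wLen S s⁻¹)
      simp only [wDist, inv_mul_cancel_left] at hxy
      linarith
    have h₂ : y * s ≠ x := by
      rintro rfl
      have := le_max_right (wLen S s : ℝ) (wLen S s⁻¹)
      simp only [wDist, mul_inv_rev, inv_mul_cancel_right] at hxy
      linarith
    simp [edgeChain, h₁, h₂]
  bound := by
    refine ⟨2 * K, by positivity, fun x y => ?_⟩
    have hx : |φ x| ≤ K * f (max (wLen S x) (wLen S y)) := (hφ x).trans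
      (mul_le_mul_of_nonneg_left (hf (by simp) (by simp) (le_max_left _ _)) hK.le)
    have hy : |φ y| ≤ K * f (max (wLen S x) (wLen S y)) := (hφ y).trans
      (mul_le_mul_of_nonneg_left (hf (by simp) (by simp) (le_max_right _ _)) hK.le)
    have h0 := (abs_nonneg _).trans hx
    refine (abs_sub _ _).trans ?_
    rw [two_mul, add_mul]
    refine add_le_add ?_ ?_ <;> split_ifs <;> simpa

end Chains

section Flow

variable {G : Type*} [Group G]

/-- Mean of `f` over the two right translates of a point by `a` and `b`. -/
noncomputable def pairMean (a b : G) (f : G → ℝ) (u : G) : ℝ :=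
  (f (u * a) + f (u * b)) / 2

theorem pairMean_iterate_succ (a b : G) (f : G → ℝ) (i : ℕ) (u : G) :
    (pairMean a b)^[i + 1] f u =
      ((pairMean a b)^[i] f (u * a) + (pairMean a b)^[i] f (u * b)) / 2 := by
  rw [Function.iterate_succ_apply']
  rfl

theorem pairMean_iterate_mono (a b : G) {f g : G → ℝ} (h : f ≤ g) (i : ℕ) :
    (pairMean a b)^[i] f ≤ (pairMean a b)^[i] g := by
  induction i with
  | zero => exact h
  | succ i ih =>
    intro u
    simp only [pairMean_iterate_succ]
    linarith [ih (u * a), ih (u * b)]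

theorem pairMean_iterate_const (a b : G) (r : ℝ) (i : ℕ) :
    (pairMean a b)^[i] (fun _ => r) = fun _ => r := by
  induction i with
  | zero => rfl
  | succ i ih =>
    funext u
    rw [pairMean_iterate_succ, ih]
    ring

theorem pairMean_iterate_const_mul (a b : G) (r : ℝ) (f : G → ℝ) (i : ℕ) :
    (pairMean a b)^[i] (fun u => r * f u) = fun u => r * (pairMean a b)^[i] f u := by
  induction i with
  | zero => rfl
  | succ i ih =>
    funext u
    simp only [pairMean_iterate_succ, ih]
    ring

/-- Push the mass of `f` off the complement of `L` by right translation by `c`. -/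
noncomputable def pushInto (L : Set G) (c : G) (f : G → ℝ) (u : G) : ℝ :=
  L.indicator f u + Lᶜ.indicator f (u * c⁻¹)

theorem pushInto_nonneg (L : Set G) (c : G) {f : G → ℝ} (hf : 0 ≤ f) : 0 ≤ pushInto L c f :=
  fun u => add_nonneg (Set.indicator_nonneg (fun x _ => hf x) u)
    (Set.indicator_nonneg (fun x _ => hf x) _)

theorem pushInto_le {L : Set G} {c : G} (hc : ∀ u ∉ L, u * c ∈ L) {f : G → ℝ} {M : ℝ}
    (hf : 0 ≤ f) (hM : ∀ u, f u ≤ M) :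
    pushInto L c f ≤ fun u => 2 * M * L.indicator 1 u := by
  intro u
  have hM0 : 0 ≤ M := (hf u).trans (hM u)
  by_cases hu : u ∈ L
  · have h : Lᶜ.indicator f (u * c⁻¹) ≤ M := Set.indicator_apply_le' (fun _ => hM _) fun _ => hM0
    simp only [pushInto, Set.indicator_of_mem hu, Pi.one_apply]
    linarith [hM u]
  · have h : u * c⁻¹ ∈ L := by
      by_contra h
      exact hu (by simpa using hc _ h)
    simp [pushInto, hu, h]

/-- If random products of `a` and `b` of length `n u` rarely lead from `u` into `L`, while right
translation by `c` maps the complement of `L` into `L`, then unit mass at every point can be moved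
to infinity along right translations by `c`, `a⁻¹` and `b⁻¹` with flow at `u` of order `n u`. -/
theorem exists_flow {a b c : G} {L : Set G} {n : G → ℕ} (hc : ∀ u ∉ L, u * c ∈ L)
    (ha : ∀ u, n (u * a) = n u) (hb : ∀ u, n (u * b) = n u)
    (hL : ∀ u, (pairMean a b)^[n u] (L.indicator 1) u ≤ 1 / 4) :
    ∃ α γ : G → ℝ, (∀ u, |α u| ≤ 2 * (n u + 1)) ∧ (∀ u, |γ u| ≤ 2 * (n u + 1)) ∧
      ∀ u, (γ (u * c⁻¹) - γ u) + (α (u * a) - α u) + (α (u * b) - α u) = 1 := by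
  let D := pushInto L c
  let P : (G → ℝ) → G → ℝ := fun f u => (pairMean a b)^[n u] (D f) u
  let m : ℕ → G → ℝ := fun k => P^[k] 1
  have hm_succ (k : ℕ) (u : G) : m (k + 1) u = (pairMean a b)^[n u] (D (m k)) u := by
    simp only [m, Function.iterate_succ_apply']
    rfl
  have hmean_nonneg {f : G → ℝ} (hf : 0 ≤ f) (i : ℕ) : 0 ≤ (pairMean a b)^[i] (D f) := by
    have h := pairMean_iterate_mono a b (pushInto_nonneg L c hf) i
    exact (pairMean_iterate_const a b 0 i).ge.trans h
  have hm (k : ℕ) : 0 ≤ m k ∧ ∀ u, m k u ≤ (1 / 2) ^ k := by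
    induction k with
    | zero => exact ⟨zero_le_one, fun u => by simp [m]⟩
    | succ k ih =>
      refine ⟨fun u => (hmean_nonneg ih.1 (n u) u).trans_eq (hm_succ k u).symm, fun u => ?_⟩
      have h := pairMean_iterate_mono a b (pushInto_le hc ih.1 ih.2) (n u) u
      rw [pairMean_iterate_const_mul] at h
      have h' := mul_le_mul_of_nonneg_left (hL u) (by positivity : (0 : ℝ) ≤ 2 * (1 / 2) ^ k)
      rw [hm_succ, pow_succ]
      exact (h.trans h').trans_eq (by ring)
  have hmean_le (k i : ℕ) (u : G) : (pairMean a b)^[i] (D (m k)) u ≤ 2 * (1 / 2) ^ k := by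
    have hD : D (m k) ≤ fun _ => 2 * (1 / 2 : ℝ) ^ k := by
      refine (pushInto_le hc (hm k).1 (hm k).2).trans fun u => ?_
      refine mul_le_of_le_one_right (by positivity) ?_
      exact Set.indicator_apply_le' (fun _ => le_rfl) fun _ => zero_le_one
    exact (pairMean_iterate_mono a b hD i u).trans_eq
      (congrFun (pairMean_iterate_const a b _ i) u)
  let A : ℕ → G → ℝ := fun k u => ∑ i ∈ Finset.range (n u), (pairMean a b)^[i] (D (m k)) u / 2
  let C : ℕ → G → ℝ := fun k => Lᶜ.indicator (m k)
  have hA0 (k : ℕ) (u : G) : 0 ≤ A k u :=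
    Finset.sum_nonneg fun i _ => div_nonneg (hmean_nonneg (hm k).1 i u) zero_le_two
  have hA (k : ℕ) (u : G) : A k u ≤ n u * (1 / 2) ^ k := by
    refine (Finset.sum_le_card_nsmul _ _ ((1 / 2) ^ k) fun i _ => ?_).trans_eq (by simp)
    linarith [hmean_le k i u]
  have hC0 (k : ℕ) (u : G) : 0 ≤ C k u := Set.indicator_nonneg (fun x _ => (hm k).1 x) u
  have hC (k : ℕ) (u : G) : C k u ≤ (1 / 2) ^ k :=
    Set.indicator_apply_le' (fun _ => (hm k).2 u) fun _ => by positivity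
  have hsA (u : G) : Summable fun k => A k u :=
    .of_nonneg_of_le (hA0 · u) (hA · u) (summable_geometric_two.mul_left _)
  have hsC (u : G) : Summable fun k => C k u :=
    .of_nonneg_of_le (hC0 · u) (hC · u) summable_geometric_two
  have hsm (u : G) : Summable fun k => m k u :=
    .of_nonneg_of_le (fun k => (hm k).1 u) (fun k => (hm k).2 u) summable_geometric_two
  have hstep (k : ℕ) (u : G) : (C k (u * c⁻¹) - C k u) + (A k (u * a) - A k u) +
      (A k (u * b) - A k u) = m (k + 1) u - m k u := by
    have hD : D (m k) u = m k u - C k u + C k (u * c⁻¹) := by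
      have := Set.indicator_self_add_compl_apply L (m k) u
      simp only [D, C, pushInto]
      linarith
    have htel := Finset.sum_range_sub (fun i => (pairMean a b)^[i] (D (m k)) u) (n u)
    simp only [pairMean_iterate_succ, Function.iterate_zero, id_eq] at htel
    rw [← hm_succ] at htel
    simp only [Finset.sum_sub_distrib, ← Finset.sum_div, Finset.sum_add_distrib] at htel
    simp only [A, ha, hb, ← Finset.sum_div]
    linarith
  refine ⟨fun u => -∑' k, A k u, fun u => -∑' k, C k u, fun u => ?_, fun u => ?_, fun u => ?_⟩
  · rw [abs_neg, abs_of_nonneg (tsum_nonneg (hA0 · u))]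
    refine ((hsA u).tsum_le_tsum (hA · u) (summable_geometric_two.mul_left _)).trans ?_
    rw [tsum_mul_left, tsum_geometric_two]
    linarith
  · rw [abs_neg, abs_of_nonneg (tsum_nonneg (hC0 · u))]
    refine ((hsC u).tsum_le_tsum (hC · u) summable_geometric_two).trans ?_
    rw [tsum_geometric_two]
    linarith [(n u).cast_nonneg (α := ℝ)]
  · have h : ∑' k, (m (k + 1) u - m k u) = -1 := by
      have h0 := (hsm u).tsum_eq_zero_add
      rw [((summable_nat_add_iff 1).2 (hsm u)).tsum_sub (hsm u)]
      simp only [m, Function.iterate_zero, id_eq, Pi.one_apply] at h0 ⊢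
      linarith
    simp only [← hstep] at h
    rw [((((hsC _).sub (hsC u)).add ((hsA _).sub (hsA u)))).tsum_add ((hsA _).sub (hsA u)),
      ((hsC _).sub (hsC u)).tsum_add ((hsA _).sub (hsA u)), (hsC _).tsum_sub (hsC u),
      (hsA _).tsum_sub (hsA u), (hsA _).tsum_sub (hsA u)] at h
    linarith

end Flow

theorem exists_list_length_eq_wLen {G : Type*} [Group G] {S : Set G} (hsym : ∀ s ∈ S, s⁻¹ ∈ S)
    (hgen : Subgroup.closure S = ⊤) (x : G) :
    ∃ l : List G, (∀ s ∈ l, s ∈ S) ∧ l.length = wLen S x ∧ l.prod = x := by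
  have hx : x ∈ Submonoid.closure (S ∪ S⁻¹) := by
    rw [← Subgroup.closure_toSubmonoid, hgen]
    trivial
  obtain ⟨l, hl, hx⟩ := Submonoid.exists_list_of_mem_closure hx
  refine Nat.sInf_mem (s := {n | ∃ l : List G, (∀ s ∈ l, s ∈ S) ∧ l.length = n ∧ l.prod = x})
    ⟨_, l, fun s hs => ?_, rfl, hx⟩
  exact (hl s hs).elim id fun h => by simpa using hsym _ h

namespace WreathProd

variable {A B : Type*} [Group A] [Group B]

open Classical in
/-- The element of the base group with value `a` at the identity and trivial elsewhere. -/
noncomputable def lamp (B : Type*) [Group B] (a : A) : WreathProd A B :=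
  SemidirectProduct.inl ⟨Pi.mulSingle 1 a,
    (Set.finite_singleton (1 : B)).subset Pi.mulSupport_mulSingle_subset⟩

/-- The value at `b` of the base component of `x`. -/
def val (x : WreathProd A B) (b : B) : A := (x.left : B → A) b

theorem val_mul (x y : WreathProd A B) (b : B) :
    (x * y).val b = x.val b * y.val (x.right⁻¹ * b) := rfl

theorem val_inr (b b' : B) : val (A := A) (SemidirectProduct.inr b) b' = 1 := rfl

theorem val_lamp_one (a : A) : (lamp B a).val 1 = a := by
  simp [lamp, val]

theorem val_lamp_of_ne (a : A) {b : B} (hb : b ≠ 1) : (lamp B a).val b = 1 := by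
  simp [lamp, val, hb]

theorem right_lamp (a : A) : (lamp B a).right = 1 := rfl

theorem val_mul_inr (x : WreathProd A B) (b b' : B) :
    (x * SemidirectProduct.inr b).val b' = x.val b' := by
  rw [val_mul, val_inr, mul_one]

/-- The number of coordinates at which the base component of `x` is nontrivial. -/
noncomputable def supportSize (x : WreathProd A B) : ℕ := (Function.mulSupport x.val).ncard

theorem finite_mulSupport_val (x : WreathProd A B) : (Function.mulSupport x.val).Finite :=
  x.left.2

theorem supportSize_mul_inr (x : WreathProd A B) (b : B) :
    supportSize (x * SemidirectProduct.inr b) = supportSize x := by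
  have h : (x * SemidirectProduct.inr b).val = x.val := funext (val_mul_inr x b)
  rw [supportSize, supportSize, h]

theorem supportSize_mul_le (x y : WreathProd A B) :
    supportSize (x * y) ≤ supportSize x + supportSize y := by
  have hsub : Function.mulSupport (x * y).val ⊆
      Function.mulSupport x.val ∪ Set.image (x.right * ·) (Function.mulSupport y.val) := by
    intro b hb
    by_contra h
    simp only [Set.mem_union, not_or, Function.notMem_mulSupport] at h
    refine hb ?_
    rw [val_mul, h.1, one_mul]
    by_contra hy
    exact h.2 ⟨_, hy, mul_inv_cancel_left _ _⟩
  calc supportSize (x * y) ≤ _ := Set.ncard_le_ncard hsub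
        ((finite_mulSupport_val x).union ((finite_mulSupport_val y).image _))
    _ ≤ _ := Set.ncard_union_le _ _
    _ ≤ _ := Nat.add_le_add_left (Set.ncard_image_le (finite_mulSupport_val y)) _

theorem supportSize_one : supportSize (1 : WreathProd A B) = 0 := by
  have h : Function.mulSupport (1 : WreathProd A B).val = ∅ := Function.mulSupport_one
  rw [supportSize, h, Set.ncard_empty]

theorem exists_supportSize_le (S : Finset (WreathProd A B)) (hsym : ∀ s ∈ S, s⁻¹ ∈ S)
    (hgen : Subgroup.closure (S : Set (WreathProd A B)) = ⊤) :
    ∃ M : ℕ, ∀ x, supportSize x ≤ M * wLen (S : Set (WreathProd A B)) x := by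
  refine ⟨S.sup supportSize, fun x => ?_⟩
  obtain ⟨l, hl, hlen, hx⟩ :=
    exists_list_length_eq_wLen (S := (S : Set (WreathProd A B))) hsym hgen x
  rw [← hlen, ← hx]
  clear hlen hx
  induction l with
  | nil => rw [List.prod_nil, supportSize_one]; exact Nat.zero_le _
  | cons s l ih =>
    have hs : supportSize s ≤ S.sup supportSize := Finset.le_sup (hl s List.mem_cons_self)
    have hl' := ih fun t ht => hl t (List.mem_cons_of_mem _ ht)
    rw [List.prod_cons, List.length_cons, Nat.mul_succ, Nat.add_comm]
    exact (supportSize_mul_le s l.prod).trans (Nat.add_le_add hs hl')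

/-- The elements of `A ≀ B` whose base component is nontrivial at the current position. -/
def litSet (A B : Type*) [Group A] [Group B] : Set (WreathProd A B) := {x | x.val x.right ≠ 1}

theorem mul_lamp_mem_litSet {a : A} (ha : a ≠ 1) (x : WreathProd A B) (hx : x ∉ litSet A B) :
    x * lamp B a ∈ litSet A B := by
  have hx' : x.val x.right = 1 := not_not.1 hx
  have hr : (x * lamp B a).right = x.right := by
    rw [SemidirectProduct.mul_right, right_lamp, mul_one]
  change (x * lamp B a).val (x * lamp B a).right ≠ 1
  rwa [hr, val_mul, hx', one_mul, inv_mul_cancel, val_lamp_one]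

theorem two_pow_mul_pairMean_litSet_le {a b : B} {R : B → Set B} (hR : ∀ g, g ∈ R g)
    (ha : ∀ g, R (g * a) ⊆ R g) (hb : ∀ g, R (g * b) ⊆ R g)
    (hab : ∀ g, Disjoint (R (g * a)) (R (g * b))) (n : ℕ) (x : WreathProd A B) :
    2 ^ n * (pairMean (SemidirectProduct.inr a) (SemidirectProduct.inr b))^[n]
      ((litSet A B).indicator 1) x ≤ ((Function.mulSupport x.val ∩ R x.right).ncard : ℝ) := by
  induction n generalizing x with
  | zero =>
    have hfin := (finite_mulSupport_val x).inter_of_left (R x.right)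
    simp only [pow_zero, one_mul, Function.iterate_zero, id_eq]
    refine Set.indicator_apply_le' (fun hx => ?_) fun _ => Nat.cast_nonneg _
    rw [Pi.one_apply, Nat.one_le_cast]
    exact (Set.ncard_pos hfin).2 ⟨x.right, hx, hR _⟩
  | succ n ih =>
    have hfin (g : B) := (finite_mulSupport_val x).inter_of_left (R g)
    have key : ((Function.mulSupport x.val ∩ R (x.right * a)).ncard : ℝ) +
        (Function.mulSupport x.val ∩ R (x.right * b)).ncard ≤
        (Function.mulSupport x.val ∩ R x.right).ncard := by
      rw [← Nat.cast_add, ← Set.ncard_union_eq ((hab _).mono Set.inter_subset_right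
        Set.inter_subset_right) (hfin _) (hfin _), ← Set.inter_union_distrib_left]
      exact_mod_cast Set.ncard_le_ncard
        (Set.inter_subset_inter_right _ (Set.union_subset (ha _) (hb _))) (hfin _)
    have hval (g : B) : (x * SemidirectProduct.inr g).val = x.val := funext (val_mul_inr x g)
    have h₁ := ih (x * SemidirectProduct.inr a)
    have h₂ := ih (x * SemidirectProduct.inr b)
    rw [hval, SemidirectProduct.mul_right, SemidirectProduct.right_inr] at h₁ h₂
    rw [pairMean_iterate_succ, pow_succ]
    linarith

end WreathProd

open WreathProd in
/-- In `F ≀ ℤ`, the generator of `ℤ` and its product with a nontrivial lamp generate a free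
semigroup; this is witnessed by sets `R g` containing every product of `g` with an element of it. -/
theorem exists_branching (F : Type*) [Group F] [Nontrivial F] :
    ∃ (a b : WreathProd F (Multiplicative ℤ))
      (R : WreathProd F (Multiplicative ℤ) → Set (WreathProd F (Multiplicative ℤ))),
      (∀ g, g ∈ R g) ∧ (∀ g, R (g * a) ⊆ R g) ∧ (∀ g, R (g * b) ⊆ R g) ∧
      ∀ g, Disjoint (R (g * a)) (R (g * b)) := by
  obtain ⟨c, hc⟩ := exists_ne (1 : F)
  let t : Multiplicative ℤ := Multiplicative.ofAdd 1
  have ht (p : Multiplicative ℤ) : p < p * t := lt_mul_of_one_lt_right' p (by decide)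
  let a : WreathProd F (Multiplicative ℤ) := SemidirectProduct.inr t
  have hval_a (g : WreathProd F (Multiplicative ℤ)) (q) : (g * a).val q = g.val q :=
    val_mul_inr g t q
  have hval_b (g : WreathProd F (Multiplicative ℤ)) (q) :
      (g * (lamp _ c * a)).val q = g.val q * (lamp _ c).val (g.right⁻¹ * q) := by
    rw [← mul_assoc, hval_a, val_mul]
  have hright_a (g : WreathProd F (Multiplicative ℤ)) : (g * a).right = g.right * t := rfl
  have hright_b (g : WreathProd F (Multiplicative ℤ)) :
      (g * (lamp _ c * a)).right = g.right * t := by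
    rw [SemidirectProduct.mul_right, SemidirectProduct.mul_right, right_lamp, one_mul]
    rfl
  refine ⟨a, lamp _ c * a, fun g => {e | ∀ q < g.right, e.val q = g.val q},
    fun g q _ => rfl, fun g e he q hq => ?_, fun g e he q hq => ?_, fun g => ?_⟩
  · rw [he q (hq.trans (ht _)), hval_a]
  · rw [he q ((hq.trans (ht _)).trans_eq (hright_b g).symm), hval_b, val_lamp_of_ne, mul_one]
    rw [Ne, inv_mul_eq_one]
    exact hq.ne'
  · refine Set.disjoint_left.2 fun e hea heb => hc ?_
    have h₁ := hea g.right (ht _)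
    have h₂ := heb g.right ((ht _).trans_eq (hright_b g).symm)
    rw [hval_a] at h₁
    rw [hval_b, inv_mul_cancel, val_lamp_one, h₁] at h₂
    exact left_eq_mul.1 h₂

theorem natLog_two_le (N M L : ℕ) (h : N ≤ M * L) :
    (Nat.log 2 N : ℝ) ≤ (Real.log 2)⁻¹ * (1 + Real.log (1 + M)) * (1 + Real.log (1 + L)) := by
  have h2 : 0 < Real.log 2 := Real.log_pos one_lt_two
  have hM : 0 ≤ Real.log (1 + (M : ℝ)) := Real.log_nonneg (by simp)
  have hL : 0 ≤ Real.log (1 + (L : ℝ)) := Real.log_nonneg (by simp)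
  have hR : (Nat.log 2 N : ℝ) * Real.log 2 ≤ Real.log (1 + M) + Real.log (1 + L) := by
    rw [← Real.log_pow, ← Real.log_mul (by positivity) (by positivity)]
    refine Real.log_le_log (by positivity) ?_
    have hpow : 2 ^ Nat.log 2 N ≤ 1 + N := by
      rcases eq_or_ne N 0 with rfl | hN
      · simp
      · exact (Nat.pow_log_le_self 2 hN).trans (Nat.le_add_left _ _)
    have : 2 ^ Nat.log 2 N ≤ (1 + M) * (1 + L) := hpow.trans (by nlinarith)
    exact_mod_cast this
  rw [mul_assoc, inv_mul_eq_div, le_div_iff₀ h2]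
  nlinarith [mul_nonneg hM hL]

/-- If `a` and `b` generate a free semigroup in `B`, as witnessed by the sets `R g`, then the
fundamental class of `A ≀ B` vanishes in logarithmically controlled homology. -/
theorem WreathProd.exists_logChain {A B : Type*} [Group A] [Group B] [Nontrivial A]
    {S : Finset (WreathProd A B)} (hsym : ∀ s ∈ S, s⁻¹ ∈ S)
    (hgen : Subgroup.closure (S : Set (WreathProd A B)) = ⊤)
    {a b : B} {R : B → Set B} (hR : ∀ g, g ∈ R g)
    (ha : ∀ g, R (g * a) ⊆ R g) (hb : ∀ g, R (g * b) ⊆ R g)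
    (hab : ∀ g, Disjoint (R (g * a)) (R (g * b))) :
    ∃ ψ : WreathProd A B → WreathProd A B → ℝ,
      IsChainW (S : Set (WreathProd A B)) (fun t => 1 + Real.log (1 + t)) ψ ∧
      ∀ x, ∑ᶠ y, ψ y x = 1 := by
  obtain ⟨v, hv⟩ := exists_ne (1 : A)
  obtain ⟨M, hM⟩ := WreathProd.exists_supportSize_le S hsym hgen
  let n : WreathProd A B → ℕ := fun x => Nat.log 2 x.supportSize + 3
  have hlit (x : WreathProd A B) :
      (pairMean (SemidirectProduct.inr a) (SemidirectProduct.inr b))^[n x]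
      ((WreathProd.litSet _ _).indicator 1) x ≤ (1 / 4 : ℝ) := by
    have h := WreathProd.two_pow_mul_pairMean_litSet_le hR ha hb hab (n x) x
    have hle : ((Function.mulSupport x.val ∩ R x.right).ncard : ℝ) ≤ x.supportSize := by
      exact_mod_cast Set.ncard_le_ncard Set.inter_subset_left x.finite_mulSupport_val
    have hlt : (x.supportSize : ℝ) < 2 ^ (Nat.log 2 x.supportSize + 1) := by
      exact_mod_cast Nat.lt_pow_succ_log_self one_lt_two _
    have hpow : (2 : ℝ) ^ n x = 2 ^ (Nat.log 2 x.supportSize + 1) * 4 := by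
      simp only [n, pow_succ]
      ring
    refine le_of_mul_le_mul_left (a := (2 : ℝ) ^ n x) ?_ (by positivity)
    linarith
  obtain ⟨α, γ, hα, hγ, hflow⟩ := exists_flow (n := n)
    (WreathProd.mul_lamp_mem_litSet hv)
    (fun x => by simp only [n, WreathProd.supportSize_mul_inr])
    (fun x => by simp only [n, WreathProd.supportSize_mul_inr]) hlit
  have hmono : MonotoneOn (fun t : ℝ => 1 + Real.log (1 + t)) (Set.Ici 0) := by
    intro s hs t _ hst
    have hs : 0 ≤ s := hs
    have := Real.log_le_log (by linarith : 0 < 1 + s) (by linarith : 1 + s ≤ 1 + t)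
    simpa using this
  have hlog2 : 0 < Real.log 2 := Real.log_pos one_lt_two
  have hlogM : 0 ≤ Real.log (1 + (M : ℝ)) := Real.log_nonneg (by simp)
  let K : ℝ := 2 * ((Real.log 2)⁻¹ * (1 + Real.log (1 + M)) + 4)
  have hK : 0 < K := by positivity
  have hbound (x : WreathProd A B) :
      2 * ((n x : ℝ) + 1) ≤ K * (1 + Real.log (1 + wLen (S : Set (WreathProd A B)) x)) := by
    have h := natLog_two_le _ _ _ (hM x)
    have hL : 0 ≤ Real.log (1 + (wLen (S : Set (WreathProd A B)) x : ℝ)) :=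
      Real.log_nonneg (by simp)
    simp only [n, K, Nat.cast_add, Nat.cast_ofNat]
    linarith
  have hchain (s : WreathProd A B) {φ : WreathProd A B → ℝ} (hφ : ∀ x, |φ x| ≤ 2 * (n x + 1)) :
      IsChainW (S : Set (WreathProd A B)) (fun t => 1 + Real.log (1 + t)) (edgeChain s φ) :=
    isChainW_edgeChain hmono s hK fun x => (hφ x).trans (hbound x)
  refine ⟨edgeChain (WreathProd.lamp _ v) γ + edgeChain (SemidirectProduct.inr a)⁻¹ α +
    edgeChain (SemidirectProduct.inr b)⁻¹ α,
    ((hchain _ hγ).add (hchain _ hα)).add (hchain _ hα), fun x => ?_⟩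
  have hfin (s : WreathProd A B) (φ : WreathProd A B → ℝ) := finite_support_edgeChain s φ x
  simp only [Pi.add_apply]
  rw [finsum_add_distrib (((hfin _ _).union (hfin _ _)).subset (Function.support_add _ _))
    (hfin _ _), finsum_add_distrib (hfin _ _) (hfin _ _)]
  simp only [finsum_edgeChain, inv_inv]
  exact hflow x

/-- For `Γ = F ≀ (F ≀ ℤ)`, `F` a nontrivial finite group, the
fundamental class vanishes in `H_0^f(Γ)` for `f(t) = 1 + ln(1+t)`. -/
theorem fundamental_class_vanishes_iterated_wreath
    (F : Type*) [Group F] [Finite F] [Nontrivial F]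
    (S : Finset (WreathProd F (WreathProd F (Multiplicative ℤ))))
    (hsym : ∀ s ∈ S, s⁻¹ ∈ S)
    (hgen : Subgroup.closure
      (S : Set (WreathProd F (WreathProd F (Multiplicative ℤ)))) = ⊤) :
    ∃ ψ : WreathProd F (WreathProd F (Multiplicative ℤ)) →
          WreathProd F (WreathProd F (Multiplicative ℤ)) → ℝ,
      IsChainW (S : Set (WreathProd F (WreathProd F (Multiplicative ℤ))))
        (fun t => 1 + Real.log (1 + t)) ψ ∧
      ∀ x, ∑ᶠ y, ψ y x = 1 := by
  obtain ⟨a, b, R, hR, ha, hb, hab⟩ := exists_branching F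
  exact WreathProd.exists_logChain hsym hgen hR ha hb hab
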